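/- Let K : k be a field extension, Λ a finite-dimensional k-algebra, and M, N finite-dimensional Λ-modules. Then M ≅ N if and only if M ⊗_k K ≅ N ⊗_k K as modules over Λ ⊗_k K. (Noether–Deuring theorem, isomorphism version.) -/

import Mathlib

open scoped TensorProduct

namespace NoetherDeuring
open Module

universe u v w

section BaseChange

variable (k K Λ X M : Type*) [Field k] [Field K] [Algebra k K] [Ring Λ] [Algebra k Λ]
  [AddCommGroup X] [Module k X] [Module Λ X] [IsScalarTower k Λ X]
  [AddCommGroup M] [Module k M] [Module Λ M] [IsScalarTower k Λ M]

/-- The `Λ`-equivariant maps `X → K ⊗[k] M`, as a `K`-subspace of the `k`-linear maps. -/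
def equivariantMaps : Submodule K (X →ₗ[k] K ⊗[k] M) where
  carrier := {φ | ∀ (a : Λ) (x : X), φ (a • x) = (Algebra.lsmul k k M a).lTensor K (φ x)}
  add_mem' hφ hψ a x := by simp [hφ a x, hψ a x]
  zero_mem' a x := by simp
  smul_mem' c φ hφ a x := by
    simp only [LinearMap.smul_apply, hφ a x]
    exact (((Algebra.lsmul k k M a).baseChange K).map_smul c (φ x)).symm

/-- The canonical map from the base change of `X →ₗ[Λ] M` to the maps `X → K ⊗[k] M`. -/
noncomputable def homBaseChange : K ⊗[k] (X →ₗ[Λ] M) →ₗ[K] (X →ₗ[k] K ⊗[k] M) :=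
  LinearMap.liftBaseChange K
    { toFun := fun f ↦ TensorProduct.mk k K M 1 ∘ₗ f.restrictScalars k
      map_add' := fun f g ↦ by ext; simp [TensorProduct.tmul_add]
      map_smul' := fun c f ↦ by ext; simp }

variable {k K Λ X M}

lemma homBaseChange_tmul (c : K) (f : X →ₗ[Λ] M) (x : X) :
    homBaseChange k K Λ X M (c ⊗ₜ f) x = c ⊗ₜ f x := by
  simp [homBaseChange, TensorProduct.smul_tmul']

lemma homBaseChange_injective : Function.Injective (homBaseChange k K Λ X M) := by
  rw [injective_iff_map_eq_zero]
  classical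
  intro z hz
  let b := Basis.ofVectorSpace k K
  obtain ⟨f, rfl⟩ := (TensorProduct.equivFinsuppOfBasisLeft b).symm.surjective z
  suffices f = 0 by simp [this]
  ext i x
  have hx := LinearMap.congr_fun hz x
  rw [TensorProduct.equivFinsuppOfBasisLeft_symm_apply, Finsupp.sum, map_sum,
    LinearMap.sum_apply] at hx
  simp only [homBaseChange_tmul, LinearMap.zero_apply] at hx
  have h := congrArg (fun w ↦ TensorProduct.equivFinsuppOfBasisLeft b w i) hx
  simp only [map_sum, Finsupp.finsetSum_apply,
    TensorProduct.equivFinsuppOfBasisLeft_apply_tmul_apply, map_zero, Finsupp.zero_apply,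
    Basis.repr_self, Finsupp.single_apply, ite_smul, one_smul, zero_smul] at h
  by_cases hi : f i = 0
  · simp [hi]
  · simpa [hi] using h

lemma range_homBaseChange [FiniteDimensional k X] :
    LinearMap.range (homBaseChange k K Λ X M) = equivariantMaps k K Λ X M := by
  apply le_antisymm
  · rintro _ ⟨z, rfl⟩ a x
    induction z with
    | zero => simp
    | add y z hy hz => simp [hy, hz]
    | tmul c f => simp [homBaseChange_tmul]
  · classical
    intro φ hφ
    let b := Basis.ofVectorSpace k K
    let E := TensorProduct.equivFinsuppOfBasisLeft (N := M) b
    have hE (a : Λ) (z : K ⊗[k] M) (i) :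
        E ((Algebra.lsmul k k M a).lTensor K z) i = a • E z i := by
      induction z with
      | zero => simp
      | add y z hy hz => simp [hy, hz]
      | tmul c m =>
        simpa [E, TensorProduct.equivFinsuppOfBasisLeft_apply_tmul_apply] using smul_comm _ a m
    let f (i) : X →ₗ[Λ] M :=
      { toFun := fun x ↦ E (φ x) i
        map_add' := by simp
        map_smul' := fun a x ↦ by simp [hφ a x, hE] }
    let c := finBasis k X
    let s := Finset.univ.biUnion fun j ↦ (E (φ (c j))).support
    refine ⟨∑ i ∈ s, b i ⊗ₜ f i, c.ext fun j ↦ E.injective ?_⟩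
    ext i
    rw [map_sum, LinearMap.sum_apply]
    simp only [homBaseChange_tmul, map_sum, Finsupp.finsetSum_apply, E,
      TensorProduct.equivFinsuppOfBasisLeft_apply_tmul_apply,
      Basis.repr_self, Finsupp.single_apply, ite_smul, one_smul, zero_smul]
    rw [Finset.sum_ite_eq']
    split_ifs with hi
    · rfl
    · simp only [s, Finset.mem_biUnion, not_exists, Finset.mem_univ, true_and,
        Finsupp.notMem_support_iff] at hi
      exact (hi j).symm

lemma finrank_equivariantMaps [FiniteDimensional k X] :
    finrank K (equivariantMaps k K Λ X M) = finrank k (X →ₗ[Λ] M) := by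
  rw [← range_homBaseChange, LinearMap.finrank_range_of_inj homBaseChange_injective,
    finrank_baseChange]

variable {N : Type*} [AddCommGroup N] [Module k N] [Module Λ N] [IsScalarTower k Λ N]

lemma finrank_hom_eq_of_baseChange [FiniteDimensional k X] (e : K ⊗[k] M ≃ₗ[K] K ⊗[k] N)
    (he : ∀ (a : Λ) z, e ((Algebra.lsmul k k M a).lTensor K z) =
      (Algebra.lsmul k k N a).lTensor K (e z)) :
    finrank k (X →ₗ[Λ] M) = finrank k (X →ₗ[Λ] N) := by
  let E : (X →ₗ[k] K ⊗[k] M) ≃ₗ[K] (X →ₗ[k] K ⊗[k] N) :=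
    LinearEquiv.ofLinearMap
      { toFun := fun φ ↦ (e : K ⊗[k] M →ₗ[K] K ⊗[k] N).restrictScalars k ∘ₗ φ
        map_add' := fun _ _ ↦ by ext; simp
        map_smul' := fun _ _ ↦ by ext; simp }
      { toFun := fun φ ↦ (e.symm : K ⊗[k] N →ₗ[K] K ⊗[k] M).restrictScalars k ∘ₗ φ
        map_add' := fun _ _ ↦ by ext; simp
        map_smul' := fun _ _ ↦ by ext; simp }
      (by ext; simp) (by ext; simp)
  have hE : (equivariantMaps k K Λ X M).map (E : _ →ₗ[K] _) = equivariantMaps k K Λ X N := by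
    ext ψ
    rw [Submodule.mem_map_equiv]
    refine forall₂_congr fun a x ↦ ?_
    change e.symm (ψ (a • x)) = (Algebra.lsmul k k M a).lTensor K (e.symm (ψ x)) ↔ _
    rw [LinearEquiv.symm_apply_eq, he, e.apply_symm_apply]
  rw [← finrank_equivariantMaps (K := K), ← finrank_equivariantMaps (K := K), ← hE]
  exact (LinearEquiv.finrank_map_eq E _).symm

end BaseChange

section Split

variable {Λ M N P : Type*} [Ring Λ] [AddCommGroup M] [Module Λ M] [AddCommGroup N] [Module Λ N]
  [AddCommGroup P] [Module Λ P]

lemma nonempty_equiv_prod_ker {a : P →ₗ[Λ] N} {b : N →ₗ[Λ] P} (h : b ∘ₗ a = LinearMap.id) :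
    Nonempty (N ≃ₗ[Λ] P × LinearMap.ker b) := by
  have h' (x) : b (a x) = x := LinearMap.congr_fun h x
  refine ⟨(LinearEquiv.ofBijective (a.coprod (LinearMap.ker b).subtype) ⟨?_, fun y ↦ ?_⟩).symm⟩
  · rw [injective_iff_map_eq_zero]
    rintro ⟨x, y, hy⟩ hxy
    rw [LinearMap.mem_ker] at hy
    simp only [LinearMap.coprod_apply, Submodule.subtype_apply] at hxy
    have hx : x = 0 := by simpa [h', hy] using congrArg b hxy
    simpa [hx] using hxy
  · exact ⟨(b y, ⟨y - a (b y), by simp [h']⟩), by simp⟩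

lemma isLocalRing_end_of_indecomposable [IsArtinian Λ P] [IsNoetherian Λ P] [Nontrivial P]
    (h : ∀ p q : Submodule Λ P, IsCompl p q → p = ⊥ ∨ p = ⊤) : IsLocalRing (End Λ P) := by
  refine IsLocalRing.of_isUnit_or_isUnit_one_sub_self fun f ↦ ?_
  obtain ⟨n, hn, hn0⟩ :=
    (f.eventually_isCompl_ker_pow_range_pow.and (Filter.eventually_ne_atTop 0)).exists
  rcases h _ _ hn with h0 | h1
  · left
    rw [h0] at hn
    rw [← isUnit_pow_iff hn0, End.isUnit_iff]
    exact ⟨LinearMap.ker_eq_bot.1 h0, LinearMap.range_eq_top.1 (eq_top_of_bot_isCompl hn)⟩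
  · exact .inr (IsNilpotent.isUnit_one_sub ⟨n, LinearMap.ker_eq_top.1 h1⟩)

variable (Λ M) in
lemma exists_indecomposable_summand [IsArtinian Λ M] [Nontrivial M] :
    ∃ P Q : Submodule Λ M, IsCompl P Q ∧ P ≠ ⊥ ∧
      ∀ p q : Submodule Λ P, IsCompl p q → p = ⊥ ∨ p = ⊤ := by
  obtain ⟨P, ⟨hP, Q, hPQ⟩, hmin⟩ := WellFounded.has_min
    (wellFounded_lt (α := Submodule Λ M)) {P | P ≠ ⊥ ∧ ∃ Q, IsCompl P Q}
    ⟨⊤, top_ne_bot, ⊥, isCompl_top_bot⟩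
  refine ⟨P, Q, hPQ, hP, fun p q hpq ↦ or_iff_not_imp_left.2 fun hp ↦ ?_⟩
  let e := Submodule.equivMapOfInjective P.subtype P.injective_subtype p
  have hc : IsCompl (p.map P.subtype)
      (LinearMap.ker (e.toLinearMap ∘ₗ p.projectionOnto q hpq ∘ₗ P.projectionOnto Q hPQ)) := by
    refine LinearMap.isCompl_of_proj fun x ↦ ?_
    obtain ⟨y, rfl⟩ := e.surjective x
    have hy : (e y : M) = ((y : P) : M) := rfl
    simp [hy]
  have hle : p.map P.subtype ≤ P := Submodule.map_subtype_le P p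
  have hne : p.map P.subtype ≠ ⊥ := fun h0 ↦
    hp (Submodule.map_injective_of_injective P.injective_subtype
      (h0.trans (Submodule.map_bot _).symm))
  have hnlt := hmin _ ⟨hne, _, hc⟩
  have heq := hle.eq_of_not_lt hnlt
  rw [eq_top_iff]
  rintro x -
  obtain ⟨y, hy, hyx⟩ : (x : M) ∈ p.map P.subtype := heq.ge x.2
  rwa [← Subtype.ext hyx]

end Split

section HomDimension

variable {k Λ : Type*} [Field k] [Ring Λ] [Algebra k Λ]

instance finiteDimensional_hom (X M : Type*)
    [AddCommGroup X] [Module k X] [Module Λ X] [IsScalarTower k Λ X] [FiniteDimensional k X]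
    [AddCommGroup M] [Module k M] [Module Λ M] [IsScalarTower k Λ M] [FiniteDimensional k M] :
    FiniteDimensional k (X →ₗ[Λ] M) :=
  Module.Finite.of_injective
    ({ toFun := fun f ↦ f.restrictScalars k
       map_add' := fun _ _ ↦ rfl
       map_smul' := fun _ _ ↦ rfl } : (X →ₗ[Λ] M) →ₗ[k] (X →ₗ[k] M))
    (LinearMap.restrictScalars_injective k)

lemma finrank_hom_congr_right (X : Type*) {M N : Type*} [AddCommGroup X] [Module Λ X]
    [AddCommGroup M] [Module k M] [Module Λ M] [IsScalarTower k Λ M]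
    [AddCommGroup N] [Module k N] [Module Λ N] [IsScalarTower k Λ N] (e : M ≃ₗ[Λ] N) :
    finrank k (X →ₗ[Λ] M) = finrank k (X →ₗ[Λ] N) :=
  LinearEquiv.finrank_eq
    { toFun := fun f ↦ e.toLinearMap ∘ₗ f
      invFun := fun f ↦ e.symm.toLinearMap ∘ₗ f
      map_add' := fun _ _ ↦ by ext; simp
      map_smul' := fun c f ↦ by ext; exact LinearMap.map_smul_of_tower e.toLinearMap c _
      left_inv := fun _ ↦ by ext; simp
      right_inv := fun _ ↦ by ext; simp }

variable (k Λ) in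
/-- The `k`-spaces of `Λ`-homomorphisms into `M` and into `N` have the same dimension, for every
finite-dimensional source. -/
def SameHomDimension (M N : Type w) [AddCommGroup M] [Module k M] [Module Λ M]
    [IsScalarTower k Λ M] [AddCommGroup N] [Module k N] [Module Λ N] [IsScalarTower k Λ N] :
    Prop :=
  ∀ (X : Type w) [AddCommGroup X] [Module k X] [Module Λ X] [IsScalarTower k Λ X]
    [FiniteDimensional k X], finrank k (X →ₗ[Λ] M) = finrank k (X →ₗ[Λ] N)

lemma finrank_range_lcomp_add_finrank_quotient {M Y T : Type*}
    [AddCommGroup M] [Module k M] [Module Λ M] [IsScalarTower k Λ M]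
    [AddCommGroup Y] [Module k Y] [Module Λ Y] [IsScalarTower k Λ Y] [FiniteDimensional k Y]
    [AddCommGroup T] [Module k T] [Module Λ T] [IsScalarTower k Λ T] [FiniteDimensional k T]
    (h : M →ₗ[Λ] Y) :
    finrank k (LinearMap.range (h.lcomp k T)) + finrank k ((Y ⧸ LinearMap.range h) →ₗ[Λ] T) =
      finrank k (Y →ₗ[Λ] T) := by
  rw [← (h.lcomp k T).finrank_range_add_finrank_ker]
  have hinj : Function.Injective ((LinearMap.range h).mkQ.lcomp k T) := fun f g hfg ↦
    Submodule.linearMap_qext _ hfg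
  have hker : LinearMap.ker (h.lcomp k T) =
      LinearMap.range ((LinearMap.range h).mkQ.lcomp k T) := by
    ext f
    constructor
    · intro hf
      refine ⟨(LinearMap.range h).liftQ f ?_, by ext; rfl⟩
      rintro _ ⟨x, rfl⟩
      exact LinearMap.congr_fun hf x
    · rintro ⟨g, rfl⟩
      ext x
      change g (Submodule.Quotient.mk (h x)) = 0
      rw [(Submodule.Quotient.mk_eq_zero _).2 (LinearMap.mem_range_self h x), map_zero]
  rw [hker, LinearMap.finrank_range_of_inj hinj]

namespace SameHomDimension

variable {M N : Type w} [AddCommGroup M] [Module k M] [Module Λ M] [IsScalarTower k Λ M]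
  [FiniteDimensional k M] [AddCommGroup N] [Module k N] [Module Λ N] [IsScalarTower k Λ N]
  [FiniteDimensional k N]

/-- The identity of `M` is a sum of endomorphisms factoring through `N`. -/
lemma exists_sum_comp_eq_id (H : SameHomDimension k Λ M N) :
    ∃ (n : ℕ) (f : Fin n → M →ₗ[Λ] N) (g : Fin n → N →ₗ[Λ] M),
      ∑ i, g i ∘ₗ f i = LinearMap.id := by
  let b := finBasis k (M →ₗ[Λ] N)
  let h : M →ₗ[Λ] (Fin (finrank k (M →ₗ[Λ] N)) → N) := LinearMap.pi b
  have hN : LinearMap.range (h.lcomp k N) = ⊤ := by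
    rw [eq_top_iff, ← b.span_eq, Submodule.span_le]
    rintro _ ⟨i, rfl⟩
    exact ⟨LinearMap.proj i, by ext; rfl⟩
  have hM : LinearMap.range (h.lcomp k M) = ⊤ := by
    have h1 := finrank_range_lcomp_add_finrank_quotient (k := k) (T := M) h
    have h2 := finrank_range_lcomp_add_finrank_quotient (k := k) (T := N) h
    rw [hN, finrank_top] at h2
    have h3 := H ((Fin (finrank k (M →ₗ[Λ] N)) → N) ⧸ LinearMap.range h)
    have h4 := H (Fin (finrank k (M →ₗ[Λ] N)) → N)
    have h5 := H M
    exact Submodule.eq_top_of_finrank_eq (by omega)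
  obtain ⟨s, hs⟩ : LinearMap.id ∈ LinearMap.range (h.lcomp k M) := hM ▸ Submodule.mem_top
  refine ⟨_, b, fun i ↦ s ∘ₗ LinearMap.single Λ (fun _ ↦ N) i, ?_⟩
  ext x
  have hx := LinearMap.congr_fun hs x
  rw [LinearMap.sum_apply]
  simp only [LinearMap.comp_apply, LinearMap.coe_single, ← map_sum]
  rw [Finset.univ_sum_single]
  exact hx

omit [FiniteDimensional k M] [FiniteDimensional k N] in
lemma of_prod {P M' N' : Type w} [AddCommGroup P] [Module k P] [Module Λ P] [IsScalarTower k Λ P]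
    [FiniteDimensional k P] [AddCommGroup M'] [Module k M'] [Module Λ M'] [IsScalarTower k Λ M']
    [FiniteDimensional k M'] [AddCommGroup N'] [Module k N'] [Module Λ N'] [IsScalarTower k Λ N']
    [FiniteDimensional k N'] (H : SameHomDimension k Λ M N)
    (eM : M ≃ₗ[Λ] P × M') (eN : N ≃ₗ[Λ] P × N') : SameHomDimension k Λ M' N' := by
  intro X _ _ _ _ _
  have h1 : finrank k (X →ₗ[Λ] M) = finrank k (X →ₗ[Λ] P) + finrank k (X →ₗ[Λ] M') := by
    rw [← finrank_prod, (LinearMap.prodEquiv k).finrank_eq]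
    exact finrank_hom_congr_right X eM
  have h2 : finrank k (X →ₗ[Λ] N) = finrank k (X →ₗ[Λ] P) + finrank k (X →ₗ[Λ] N') := by
    rw [← finrank_prod, (LinearMap.prodEquiv k).finrank_eq]
    exact finrank_hom_congr_right X eN
  have := H X
  omega

omit [FiniteDimensional k M] in
lemma subsingleton (H : SameHomDimension k Λ M N) [Subsingleton M] : Subsingleton N := by
  have h : finrank k (N →ₗ[Λ] N) = 0 := by rw [← H N, finrank_zero_of_subsingleton]
  have := finrank_zero_iff.1 h
  refine ⟨fun x y ↦ ?_⟩
  have hxy := LinearMap.congr_fun (Subsingleton.elim (LinearMap.id : N →ₗ[Λ] N) 0)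
  rw [← LinearMap.id_apply (R := Λ) x, ← LinearMap.id_apply (R := Λ) y, hxy, hxy]
  rfl

/-- A nonzero `M` shares a nonzero direct summand with `N`. -/
lemma exists_common_summand (H : SameHomDimension k Λ M N) [Nontrivial M] :
    ∃ (P Q : Submodule Λ M) (R : Submodule Λ N), P ≠ ⊥ ∧ IsCompl P Q ∧
      Nonempty (N ≃ₗ[Λ] P × R) := by
  have : IsArtinian Λ M := isArtinian_of_tower k inferInstance
  have : IsNoetherian Λ M := isNoetherian_of_tower k inferInstance
  obtain ⟨P, Q, hPQ, hP, hind⟩ := exists_indecomposable_summand Λ M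
  have : Nontrivial P := Submodule.nontrivial_iff_ne_bot.2 hP
  have := isLocalRing_end_of_indecomposable hind
  obtain ⟨n, f, g, hfg⟩ := H.exists_sum_comp_eq_id
  let π := P.projectionOnto Q hPQ
  let u (i : Fin n) : End Λ P := (π ∘ₗ g i) ∘ₗ (f i ∘ₗ P.subtype)
  have hu : ∑ i, u i = 1 := by
    ext x
    have hx := congrArg π (LinearMap.congr_fun hfg x)
    rw [LinearMap.sum_apply, map_sum] at hx
    rw [LinearMap.sum_apply]
    exact congrArg Subtype.val (hx.trans (P.projectionOnto_apply_left hPQ x))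
  obtain ⟨i, -, hi⟩ := IsLocalRing.exists_of_isUnit_sum (s := Finset.univ) (f := u)
    (hu ▸ isUnit_one)
  obtain ⟨v, hv⟩ := hi.exists_left_inv
  exact ⟨P, Q, _, hP, hPQ, nonempty_equiv_prod_ker
    (a := f i ∘ₗ P.subtype) (b := v ∘ₗ π ∘ₗ g i) hv⟩

theorem nonempty_linearEquiv (H : SameHomDimension k Λ M N) : Nonempty (M ≃ₗ[Λ] N) := by
  induction hn : finrank k M using Nat.strong_induction_on generalizing M N with
  | _ n ih =>
    rcases subsingleton_or_nontrivial M with hM | hM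
    · have := H.subsingleton
      exact ⟨0⟩
    · obtain ⟨P, Q, R, hP, hPQ, ⟨eN⟩⟩ := H.exists_common_summand
      have hfin {L : Type w} [AddCommGroup L] [Module k L] [Module Λ L] [IsScalarTower k Λ L]
          [FiniteDimensional k L] (S : Submodule Λ L) : FiniteDimensional k S :=
        Module.Finite.of_injective (S.subtype.restrictScalars k) S.injective_subtype
      have := hfin P
      have := hfin Q
      have := hfin R
      let eM := (P.prodEquivOfIsCompl Q hPQ).symm
      have hlt : finrank k Q < n := by
        have : Nontrivial P := Submodule.nontrivial_iff_ne_bot.2 hP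
        have hpos : 0 < finrank k P := finrank_pos
        have := (eM.restrictScalars k).finrank_eq
        rw [finrank_prod] at this
        omega
      obtain ⟨e⟩ := ih _ hlt (H.of_prod eM eN) rfl
      exact ⟨eM ≪≫ₗ (LinearEquiv.refl Λ P).prodCongr e ≪≫ₗ eN.symm⟩

end SameHomDimension

end HomDimension

section BaseChangedAction

variable {k K Λ M N : Type*} [Field k] [Field K] [Algebra k K] [Ring Λ] [Algebra k Λ]
  [AddCommGroup M] [Module k M] [Module Λ M] [IsScalarTower k Λ M]
  [AddCommGroup N] [Module k N] [Module Λ N] [IsScalarTower k Λ N]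
  [Module (Λ ⊗[k] K) (M ⊗[k] K)] [Module (Λ ⊗[k] K) (N ⊗[k] K)]

omit [Module (Λ ⊗[k] K) (N ⊗[k] K)] in
lemma comm_tmul_smul (hM : ∀ (a : Λ) (c : K) (m : M) (d : K),
      (a ⊗ₜ[k] c) • (m ⊗ₜ[k] d) = (a • m) ⊗ₜ[k] (c * d)) (a : Λ) (c : K) (z : M ⊗[k] K) :
    TensorProduct.comm k M K ((a ⊗ₜ[k] c) • z) =
      c • (Algebra.lsmul k k M a).lTensor K (TensorProduct.comm k M K z) := by
  induction z with
  | zero => simp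
  | add y z hy hz => simp [hy, hz]
  | tmul m d => simp [hM, TensorProduct.smul_tmul']

lemma exists_equivariant_linearEquiv
    (hM : ∀ (a : Λ) (c : K) (m : M) (d : K),
      (a ⊗ₜ[k] c) • (m ⊗ₜ[k] d) = (a • m) ⊗ₜ[k] (c * d))
    (hN : ∀ (a : Λ) (c : K) (n : N) (d : K),
      (a ⊗ₜ[k] c) • (n ⊗ₜ[k] d) = (a • n) ⊗ₜ[k] (c * d))
    (e : (M ⊗[k] K) ≃ₗ[Λ ⊗[k] K] (N ⊗[k] K)) :
    ∃ e' : K ⊗[k] M ≃ₗ[K] K ⊗[k] N, ∀ (a : Λ) z, e' ((Algebra.lsmul k k M a).lTensor K z) =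
      (Algebra.lsmul k k N a).lTensor K (e' z) := by
  let e₀ : K ⊗[k] M ≃+ K ⊗[k] N := (TensorProduct.comm k M K).symm.toAddEquiv.trans
    (e.toAddEquiv.trans (TensorProduct.comm k N K).toAddEquiv)
  have he₀ (a : Λ) (c : K) (z) : e₀ (c • (Algebra.lsmul k k M a).lTensor K z) =
      c • (Algebra.lsmul k k N a).lTensor K (e₀ z) := by
    obtain ⟨z, rfl⟩ := (TensorProduct.comm k M K).surjective z
    rw [← comm_tmul_smul hM]
    change TensorProduct.comm k N K (e ((TensorProduct.comm k M K).symm _)) =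
      c • (Algebra.lsmul k k N a).lTensor K
        (TensorProduct.comm k N K (e ((TensorProduct.comm k M K).symm _)))
    rw [LinearEquiv.symm_apply_apply, LinearEquiv.symm_apply_apply, map_smul, comm_tmul_smul hN]
  exact ⟨e₀.toLinearEquiv fun c z ↦ by simpa [Module.End.one_eq_id] using he₀ 1 c z,
    fun a z ↦ by simpa using he₀ a 1 z⟩

lemma nonempty_baseChange_equiv
    (hM : ∀ (a : Λ) (c : K) (m : M) (d : K),
      (a ⊗ₜ[k] c) • (m ⊗ₜ[k] d) = (a • m) ⊗ₜ[k] (c * d))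
    (hN : ∀ (a : Λ) (c : K) (n : N) (d : K),
      (a ⊗ₜ[k] c) • (n ⊗ₜ[k] d) = (a • n) ⊗ₜ[k] (c * d))
    (e : M ≃ₗ[Λ] N) : Nonempty ((M ⊗[k] K) ≃ₗ[Λ ⊗[k] K] (N ⊗[k] K)) := by
  let E := TensorProduct.congr (e.restrictScalars k) (LinearEquiv.refl k K)
  refine ⟨E.toAddEquiv.toLinearEquiv fun r z ↦ ?_⟩
  change E (r • z) = r • E z
  induction r with
  | zero => simp
  | add r s hr hs => simp [add_smul, hr, hs]
  | tmul a c =>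
    induction z with
    | zero => simp
    | add y z hy hz => simp [hy, hz]
    | tmul m d => simp [E, hM, hN]

end BaseChangedAction

/-- Base change reflects isomorphism, for an isomorphism that is both `K`-linear and
`Λ`-equivariant. -/
theorem nonempty_linearEquiv_of_baseChange {k K Λ : Type*} {M : Type u} {N : Type v}
    [Field k] [Field K] [Algebra k K] [Ring Λ] [Algebra k Λ]
    [AddCommGroup M] [Module k M] [Module Λ M] [IsScalarTower k Λ M] [FiniteDimensional k M]
    [AddCommGroup N] [Module k N] [Module Λ N] [IsScalarTower k Λ N] [FiniteDimensional k N]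
    (e : K ⊗[k] M ≃ₗ[K] K ⊗[k] N)
    (he : ∀ (a : Λ) z, e ((Algebra.lsmul k k M a).lTensor K z) =
      (Algebra.lsmul k k N a).lTensor K (e z)) : Nonempty (M ≃ₗ[Λ] N) := by
  let eM : ULift.{v} M ≃ₗ[Λ] M := ULift.moduleEquiv
  let eN : ULift.{u} N ≃ₗ[Λ] N := ULift.moduleEquiv
  obtain ⟨f⟩ : Nonempty (ULift.{v} M ≃ₗ[Λ] ULift.{u} N) := by
    refine SameHomDimension.nonempty_linearEquiv (k := k) fun X _ _ _ _ _ ↦ ?_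
    rw [finrank_hom_congr_right X eM, finrank_hom_congr_right X eN,
      finrank_hom_eq_of_baseChange e he]
  exact ⟨eM.symm ≪≫ₗ f ≪≫ₗ eN⟩

end NoetherDeuring

/-- **Noether–Deuring theorem** (isomorphism version): for a field extension `K : k`,
a finite-dimensional `k`-algebra `Λ` and finite-dimensional `Λ`-modules `M`, `N`, we have
`M ≅ N` if and only if `M ⊗[k] K ≅ N ⊗[k] K` as modules over `Λ ⊗[k] K`.
The `Λ ⊗[k] K`-module structures on the base-changed modules are specified on pure
tensors by `(a ⊗ₜ c) • (m ⊗ₜ d) = (a • m) ⊗ₜ (c * d)`. -/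
theorem stmt0 (k K Λ M N : Type*) [Field k] [Field K] [Algebra k K]
    [Ring Λ] [Algebra k Λ] [FiniteDimensional k Λ]
    [AddCommGroup M] [Module k M] [Module Λ M] [IsScalarTower k Λ M] [FiniteDimensional k M]
    [AddCommGroup N] [Module k N] [Module Λ N] [IsScalarTower k Λ N] [FiniteDimensional k N]
    [Module (Λ ⊗[k] K) (M ⊗[k] K)] [Module (Λ ⊗[k] K) (N ⊗[k] K)]
    (hM : ∀ (a : Λ) (c : K) (m : M) (d : K),
      (a ⊗ₜ[k] c) • (m ⊗ₜ[k] d) = (a • m) ⊗ₜ[k] (c * d))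
    (hN : ∀ (a : Λ) (c : K) (n : N) (d : K),
      (a ⊗ₜ[k] c) • (n ⊗ₜ[k] d) = (a • n) ⊗ₜ[k] (c * d)) :
    Nonempty (M ≃ₗ[Λ] N) ↔ Nonempty ((M ⊗[k] K) ≃ₗ[Λ ⊗[k] K] (N ⊗[k] K)) := by
  refine ⟨fun ⟨e⟩ ↦ NoetherDeuring.nonempty_baseChange_equiv hM hN e, fun ⟨e⟩ ↦ ?_⟩
  obtain ⟨e', he'⟩ := NoetherDeuring.exists_equivariant_linearEquiv hM hN e
  exact NoetherDeuring.nonempty_linearEquiv_of_baseChange e' he'
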